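/- arXiv:2002.02838 — 3 statements merged into one kernel-verified Lean document; each statement's English description precedes it below -/
import Mathlib

section
/- Let ψ : ℝ^d → ℂ be continuous with compact support. Then the Bloch transform is an isometry in the sense that ∫_{[-π,π]^d} ∫_{[-1/2,1/2]^d} |(Jψ)(k; x)|² dx dk = ∫_{ℝ^d} |ψ(x)|² dx. -/
open MeasureTheory Complex Real Filter ComplexConjugate

noncomputable section

/-- The lattice point `j ∈ ℤ^d` viewed as a point of `ℝ^d`. -/
def lattE (d : ℕ) (j : Fin d → ℤ) : Fin d → ℝ := fun i => (j i : ℝ)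

/-- The Euclidean inner product on `ℝ^d`. -/
def dotE (d : ℕ) (k x : Fin d → ℝ) : ℝ := ∑ i, k i * x i

/-- The (Floquet-)Bloch transform `(Jψ)(k;x) = (2π)^{-d/2} Σ_{j∈ℤ^d} ψ(x+j) e^{-i k·j}`. -/
def BlochT (d : ℕ) (ψ : (Fin d → ℝ) → ℂ) (k x : Fin d → ℝ) : ℂ :=
  (((2 * π) ^ (-(d : ℝ) / 2) : ℝ) : ℂ) *
    ∑' j : Fin d → ℤ, ψ (x + lattE d j) * Complex.exp (-(Complex.I * ((dotE d k (lattE d j) : ℝ) : ℂ)))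

/-- The cells of points that round to a given lattice point are measurable. -/
theorem measurableSet_round_eq {ι : Type*} [Countable ι] (j : ι → ℤ) :
    MeasurableSet {x : ι → ℝ | ∀ i, round (x i) = j i} := by
  simp only [round_eq, Set.ofPred_forall]
  refine MeasurableSet.iInter fun i => ?_
  have h : Measurable fun x : ι → ℝ => ⌊x i + 1 / 2⌋ := by fun_prop
  exact h (measurableSet_singleton (j i))

theorem round_eq_zero_ae_eq_Icc {ι : Type*} [Fintype ι] :
    {x : ι → ℝ | ∀ i, round (x i) = 0} =ᵐ[volume]
      Set.Icc (fun _ : ι => -(1 / 2 : ℝ)) (fun _ : ι => (1 / 2 : ℝ)) := by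
  have h : {x : ι → ℝ | ∀ i, round (x i) = 0} =
      Set.univ.pi fun _ : ι => Set.Ico (-(1 / 2 : ℝ)) (1 / 2) := by
    ext x
    simp [round_eq_zero_iff]
  rw [h]
  exact Measure.univ_pi_Ico_ae_eq_Icc

/-- The integral of a function over `ℝ^ι` is the sum over the lattice `ℤ^ι` of the integrals of
its translates over the unit cell. -/
theorem hasSum_setIntegral_Icc_add_intCast {ι E : Type*} [Fintype ι] [NormedAddCommGroup E]
    [NormedSpace ℝ E] {f : (ι → ℝ) → E} (hf : Integrable f) :
    HasSum (fun j : ι → ℤ =>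
      ∫ x in Set.Icc (fun _ : ι => -(1 / 2 : ℝ)) (fun _ : ι => (1 / 2 : ℝ)),
        f (x + fun i => (j i : ℝ))) (∫ x, f x) := by
  have hU : (⋃ j : ι → ℤ, {x : ι → ℝ | ∀ i, round (x i) = j i}) = Set.univ :=
    Set.eq_univ_of_forall fun x => Set.mem_iUnion.2 ⟨fun i => round (x i), fun _ => rfl⟩
  have hd : Pairwise (Function.onFun Disjoint
      fun j : ι → ℤ => {x : ι → ℝ | ∀ i, round (x i) = j i}) := fun j l hjl =>
    Set.disjoint_left.2 fun x hx hx' => hjl (funext fun i => (hx i).symm.trans (hx' i))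
  have h := hasSum_integral_iUnion measurableSet_round_eq hd hf.integrableOn
  rw [hU, setIntegral_univ] at h
  convert h using 2 with j
  rw [← setIntegral_congr_set round_eq_zero_ae_eq_Icc,
    ← (measurePreserving_add_right volume fun i => (j i : ℝ)).setIntegral_preimage_emb
      (measurableEmbedding_addRight _) f {x | ∀ i, round (x i) = j i}]
  congr 2
  ext x
  simp

theorem integral_exp_neg_I_mul_intCast (m : ℤ) :
    ∫ t in Set.Icc (-π) π, Complex.exp (-(Complex.I * ((t * m : ℝ) : ℂ))) =
      if m = 0 then 2 * (π : ℂ) else 0 := by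
  rw [integral_Icc_eq_integral_Ioc,
    ← intervalIntegral.integral_of_le (by linarith [Real.pi_pos])]
  split_ifs with h
  · subst h
    simp
    ring
  · have hc : -(Complex.I * m) ≠ 0 := by simp [h]
    have he : Complex.exp (-(Complex.I * m) * π) =
        Complex.exp (-(Complex.I * m) * ((-π : ℝ) : ℂ)) :=
      Complex.exp_eq_exp_iff_exists_int.2 ⟨-m, by push_cast; ring⟩
    calc _ = ∫ t in (-π)..π, Complex.exp (-(Complex.I * m) * (t : ℂ)) :=
          intervalIntegral.integral_congr fun t _ => by
            congr 1
            push_cast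
            ring
      _ = 0 := by rw [integral_exp_mul_complex hc, he, sub_self, zero_div]

/-- Orthogonality of the characters `k ↦ e^{-i k·m}` over the Brillouin zone. -/
theorem integral_exp_neg_I_mul_dotE (d : ℕ) (m : Fin d → ℤ) :
    ∫ k in Set.Icc (fun _ : Fin d => -π) (fun _ : Fin d => π),
        Complex.exp (-(Complex.I * ((dotE d k (lattE d m) : ℝ) : ℂ))) =
      if m = 0 then (2 * (π : ℂ)) ^ d else 0 := by
  have he (k : Fin d → ℝ) :
      Complex.exp (-(Complex.I * ((dotE d k (lattE d m) : ℝ) : ℂ))) =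
        ∏ i, Complex.exp (-(Complex.I * ((k i * m i : ℝ) : ℂ))) := by
    rw [← Complex.exp_sum, dotE, Complex.ofReal_sum, Finset.mul_sum, Finset.sum_neg_distrib]
    rfl
  simp_rw [he]
  rw [← Set.pi_univ_Icc, volume_pi, Measure.restrict_pi_pi,
    integral_fintype_prod_eq_prod
      (fun (i : Fin d) (t : ℝ) => Complex.exp (-(Complex.I * ((t * m i : ℝ) : ℂ))))]
  simp_rw [integral_exp_neg_I_mul_intCast]
  split_ifs with h
  · simp [h]
  · obtain ⟨i, hi⟩ := Function.ne_iff.1 h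
    exact Finset.prod_eq_zero (Finset.mem_univ i) (if_neg hi)

theorem exp_neg_I_mul_dotE_mul_conj (d : ℕ) (k : Fin d → ℝ) (j l : Fin d → ℤ) :
    Complex.exp (-(Complex.I * ((dotE d k (lattE d j) : ℝ) : ℂ))) *
        conj (Complex.exp (-(Complex.I * ((dotE d k (lattE d l) : ℝ) : ℂ)))) =
      Complex.exp (-(Complex.I * ((dotE d k (lattE d (j - l)) : ℝ) : ℂ))) := by
  have h : dotE d k (lattE d (j - l)) = dotE d k (lattE d j) - dotE d k (lattE d l) := by
    simp [dotE, lattE, mul_sub]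
  rw [← Complex.exp_conj, ← Complex.exp_add, h]
  congr 1
  simp
  ring

theorem continuous_dotE_left (d : ℕ) (x : Fin d → ℝ) : Continuous fun k => dotE d k x := by
  unfold dotE
  fun_prop

/-- Only finitely many lattice translates of the unit cell meet the support of a compactly
supported function. -/
theorem exists_finset_forall_add_lattE_eq_zero (d : ℕ) {ψ : (Fin d → ℝ) → ℂ}
    (hsupp : HasCompactSupport ψ) :
    ∃ S : Finset (Fin d → ℤ), ∀ j ∉ S,
      ∀ x ∈ Set.Icc (fun _ : Fin d => -(1 / 2 : ℝ)) (fun _ : Fin d => (1 / 2 : ℝ)),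
        ψ (x + lattE d j) = 0 := by
  obtain ⟨R, hR⟩ := hsupp.isCompact.isBounded.subset_closedBall 0
  refine ⟨Fintype.piFinset fun _ => Finset.Icc (-(⌈R⌉ + 1)) (⌈R⌉ + 1), fun j hj x hx => ?_⟩
  contrapose! hj
  have hn : ‖x + lattE d j‖ ≤ R :=
    mem_closedBall_zero_iff.1 (hR (subset_tsupport _ hj))
  refine Fintype.mem_piFinset.2 fun i => ?_
  have hi : |x i + j i| ≤ R := (norm_le_pi_norm (x + lattE d j) i).trans hn
  have hx₁ : -(1 / 2) ≤ x i := hx.1 i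
  have hx₂ : x i ≤ 1 / 2 := hx.2 i
  have hR' := Int.le_ceil R
  rw [abs_le] at hi
  rw [Finset.mem_Icc]
  constructor
  · have : (((-(⌈R⌉ + 1) : ℤ)) : ℝ) ≤ j i := by push_cast; linarith [hi.1]
    exact_mod_cast this
  · have : (j i : ℝ) ≤ ((⌈R⌉ + 1 : ℤ) : ℝ) := by push_cast; linarith [hi.2]
    exact_mod_cast this

theorem rpow_neg_div_two_sq_mul_pow (d : ℕ) :
    (((2 * π) ^ (-(d : ℝ) / 2) : ℝ) : ℂ) ^ 2 * (2 * (π : ℂ)) ^ d = 1 := by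
  have hp : 0 < 2 * π := by positivity
  have h : ((2 * π) ^ (-(d : ℝ) / 2)) ^ 2 * (2 * π) ^ d = 1 := by
    rw [← Real.rpow_natCast _ 2, ← Real.rpow_mul hp.le, ← Real.rpow_natCast _ d,
      ← Real.rpow_add hp]
    simp
  exact_mod_cast h

/-- If the lattice sum reduces to a finite sum, then the squared modulus of the Bloch transform
is a finite double sum. -/
theorem norm_sq_BlochT_eq_sum (d : ℕ) {ψ : (Fin d → ℝ) → ℂ} {S : Finset (Fin d → ℤ)}
    {x : Fin d → ℝ} (hS : ∀ j ∉ S, ψ (x + lattE d j) = 0) (k : Fin d → ℝ) :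
    ((‖BlochT d ψ k x‖ ^ 2 : ℝ) : ℂ) =
      ∑ j ∈ S, ∑ l ∈ S, ψ (x + lattE d j) * conj (ψ (x + lattE d l)) *
        ((((2 * π) ^ (-(d : ℝ) / 2) : ℝ) : ℂ) ^ 2 *
          Complex.exp (-(Complex.I * ((dotE d k (lattE d (j - l)) : ℝ) : ℂ)))) := by
  rw [Complex.ofReal_pow, ← Complex.mul_conj', BlochT,
    tsum_eq_sum (s := S) fun j hj => by rw [hS j hj, zero_mul], map_mul, Complex.conj_ofReal,
    map_sum, mul_mul_mul_comm, Finset.sum_mul_sum, Finset.mul_sum]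
  refine Finset.sum_congr rfl fun j _ => ?_
  rw [Finset.mul_sum]
  refine Finset.sum_congr rfl fun l _ => ?_
  rw [← exp_neg_I_mul_dotE_mul_conj, map_mul]
  ring

theorem setIntegral_norm_sq_BlochT_eq_sum (d : ℕ) {ψ : (Fin d → ℝ) → ℂ} (hcont : Continuous ψ)
    {Q : Set (Fin d → ℝ)} (hQ : IsCompact Q) {S : Finset (Fin d → ℤ)}
    (hS : ∀ j ∉ S, ∀ x ∈ Q, ψ (x + lattE d j) = 0) (k : Fin d → ℝ) :
    ((∫ x in Q, ‖BlochT d ψ k x‖ ^ 2 : ℝ) : ℂ) =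
      ∑ j ∈ S, ∑ l ∈ S, (∫ x in Q, ψ (x + lattE d j) * conj (ψ (x + lattE d l))) *
        ((((2 * π) ^ (-(d : ℝ) / 2) : ℝ) : ℂ) ^ 2 *
          Complex.exp (-(Complex.I * ((dotE d k (lattE d (j - l)) : ℝ) : ℂ)))) := by
  have hint (j l : Fin d → ℤ) (a : ℂ) : Integrable
      (fun x => ψ (x + lattE d j) * conj (ψ (x + lattE d l)) * a) (volume.restrict Q) := by
    refine ContinuousOn.integrableOn_compact hQ (Continuous.continuousOn ?_)
    fun_prop
  rw [← integral_complex_ofReal, setIntegral_congr_fun hQ.measurableSet fun x hx =>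
    norm_sq_BlochT_eq_sum d (fun j hj => hS j hj x hx) k,
    integral_finsetSum _ fun j _ => integrable_finsetSum _ fun l _ => hint j l _]
  refine Finset.sum_congr rfl fun j _ => ?_
  rw [integral_finsetSum _ fun l _ => hint j l _]
  exact Finset.sum_congr rfl fun l _ => integral_mul_const _ _

theorem sum_setIntegral_norm_sq_add_lattE (d : ℕ) {ψ : (Fin d → ℝ) → ℂ} (hcont : Continuous ψ)
    (hsupp : HasCompactSupport ψ) {S : Finset (Fin d → ℤ)}
    (hS : ∀ j ∉ S, ∀ x ∈ Set.Icc (fun _ : Fin d => -(1 / 2 : ℝ)) (fun _ : Fin d => (1 / 2 : ℝ)),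
      ψ (x + lattE d j) = 0) :
    ∑ j ∈ S, ∫ x in Set.Icc (fun _ : Fin d => -(1 / 2 : ℝ)) (fun _ : Fin d => (1 / 2 : ℝ)),
      ‖ψ (x + lattE d j)‖ ^ 2 = ∫ x, ‖ψ x‖ ^ 2 := by
  have hc : HasCompactSupport fun x => ‖ψ x‖ ^ 2 :=
    hsupp.comp_left (g := fun z : ℂ => ‖z‖ ^ 2) (by simp)
  have hint : Integrable fun x => ‖ψ x‖ ^ 2 :=
    (hcont.norm.pow 2).integrable_of_hasCompactSupport hc
  rw [← (hasSum_setIntegral_Icc_add_intCast hint).tsum_eq]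
  refine (tsum_eq_sum fun j hj => ?_).symm
  refine setIntegral_eq_zero_of_forall_eq_zero fun x hx => ?_
  simp [hS j hj x hx]

/-- the Bloch transform is an `L²` isometry:
`∫_{[-π,π]^d} ∫_{[-1/2,1/2]^d} |(Jψ)(k;x)|² dx dk = ∫_{ℝ^d} |ψ(x)|² dx`. -/
theorem bloch_isometry (d : ℕ) (hd : 1 ≤ d)
    (ψ : (Fin d → ℝ) → ℂ) (hcont : Continuous ψ) (hsupp : HasCompactSupport ψ) :
    (∫ k in Set.Icc (fun _ : Fin d => -π) (fun _ : Fin d => π),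
        ∫ x in Set.Icc (fun _ : Fin d => -(1/2 : ℝ)) (fun _ : Fin d => (1/2 : ℝ)),
          ‖BlochT d ψ k x‖ ^ 2) =
      ∫ x : Fin d → ℝ, ‖ψ x‖ ^ 2 := by
  obtain ⟨S, hS⟩ := exists_finset_forall_add_lattE_eq_zero d hsupp
  have hint (j l : Fin d → ℤ) (a : ℂ) : Integrable (fun k => a *
      ((((2 * π) ^ (-(d : ℝ) / 2) : ℝ) : ℂ) ^ 2 *
        Complex.exp (-(Complex.I * ((dotE d k (lattE d (j - l)) : ℝ) : ℂ)))))
      (volume.restrict (Set.Icc (fun _ : Fin d => -π) (fun _ : Fin d => π))) := by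
    refine ContinuousOn.integrableOn_compact isCompact_Icc (Continuous.continuousOn ?_)
    have := continuous_dotE_left d (lattE d (j - l))
    fun_prop
  rw [← Complex.ofReal_inj, ← sum_setIntegral_norm_sq_add_lattE d hcont hsupp hS,
    ← integral_complex_ofReal]
  simp_rw [setIntegral_norm_sq_BlochT_eq_sum d hcont isCompact_Icc hS]
  rw [integral_finsetSum _ fun j _ => integrable_finsetSum _ fun l _ => hint j l _,
    Complex.ofReal_sum]
  refine Finset.sum_congr rfl fun j hj => ?_
  rw [integral_finsetSum _ fun l _ => hint j l _]
  simp_rw [integral_const_mul, integral_exp_neg_I_mul_dotE, sub_eq_zero, mul_ite, mul_zero]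
  rw [Finset.sum_ite_eq, if_pos hj, rpow_neg_div_two_sq_mul_pow, mul_one,
    ← integral_complex_ofReal]
  simp_rw [Complex.mul_conj', Complex.ofReal_pow]
end
end

section
/- Let G : ℝ^d → ℝ be continuously differentiable and I-periodic, let ρ : ℝ^d → ℝ be I-periodic, and let λ ∈ ℂ. Let u : ℝ^d → ℂ be twice continuously differentiable with compact support, and set g(x) := −div(G(x)∇u(x)) − λ ρ(x) u(x). Then for every k ∈ ℝ^d the function x ↦ (Ju)(k; x) is twice continuously differentiable, and the Bloch transform intertwines the periodic-coefficient operator: −div_x(G(x) ∇_x (Ju)(k; x)) − λ ρ(x) (Ju)(k; x) = (Jg)(k; x) for all k, x ∈ ℝ^d. -/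
open MeasureTheory Complex Real Filter ComplexConjugate

noncomputable section

/-- Partial derivative `∂_l f` of a complex-valued function on `ℝ^d`. -/
def pdC (d : ℕ) (l : Fin d) (f : (Fin d → ℝ) → ℂ) (x : Fin d → ℝ) : ℂ :=
  fderiv ℝ f x (Pi.single l 1)

/-- The divergence-form operator `div(G ∇u)(x) = Σ_l ∂_l (G ∂_l u)(x)`. -/
def divGgrad (d : ℕ) (G : (Fin d → ℝ) → ℝ) (u : (Fin d → ℝ) → ℂ) (x : Fin d → ℝ) : ℂ :=
  ∑ l, pdC d l (fun y => (G y : ℂ) * pdC d l u y) x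

open scoped Topology

/-- The phase `e^{-i k·j}` attached to a lattice point by the Bloch transform. -/
def blochPhase (d : ℕ) (k : Fin d → ℝ) (j : Fin d → ℤ) : ℂ :=
  Complex.exp (-(Complex.I * ((dotE d k (lattE d j) : ℝ) : ℂ)))

/-- The normalization `(2π)^{-d/2}` of the Bloch transform. -/
def blochConst (d : ℕ) : ℂ := (((2 * π) ^ (-(d : ℝ) / 2) : ℝ) : ℂ)

lemma BlochT_eq (d : ℕ) (f : (Fin d → ℝ) → ℂ) (k x : Fin d → ℝ) :
    BlochT d f k x = blochConst d * ∑' j, f (x + lattE d j) * blochPhase d k j := rfl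

/-- Near any point, only finitely many lattice translates of a compactly supported function
are nonzero. -/
lemma HasCompactSupport.exists_finset_eventually_lattE {d : ℕ} {f : (Fin d → ℝ) → ℂ}
    (hf : HasCompactSupport f) (x : Fin d → ℝ) :
    ∃ S : Finset (Fin d → ℤ), ∀ᶠ y in 𝓝 x, ∀ j ∉ S, f (y + lattE d j) = 0 := by
  obtain ⟨R, hR⟩ := hf.isCompact.isBounded.exists_norm_le
  set N : ℤ := ⌈R + ‖x‖ + 1⌉
  refine ⟨Finset.Icc (fun _ => -N) (fun _ => N), ?_⟩
  filter_upwards [Metric.ball_mem_nhds x one_pos] with y hy j hj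
  by_contra hne
  apply hj
  have hbound := hR _ (subset_tsupport f (Function.mem_support.mpr hne))
  have hy' : ‖y‖ ≤ ‖x‖ + 1 := by
    rw [Metric.mem_ball, dist_eq_norm] at hy
    linarith [norm_le_norm_add_norm_sub x y, norm_sub_rev x y]
  have hj' : ‖lattE d j‖ ≤ R + ‖x‖ + 1 := by
    have := norm_sub_le (y + lattE d j) y
    rw [add_sub_cancel_left] at this
    linarith
  have hcoord (i : Fin d) : |j i| ≤ N := by
    have h := (norm_le_pi_norm (lattE d j) i).trans (hj'.trans (Int.le_ceil _))
    rw [Real.norm_eq_abs, lattE] at h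
    exact_mod_cast h
  rw [Finset.mem_Icc]
  exact ⟨fun i => (abs_le.mp (hcoord i)).1, fun i => (abs_le.mp (hcoord i)).2⟩

lemma HasCompactSupport.summable_blochT {d : ℕ} {f : (Fin d → ℝ) → ℂ}
    (hf : HasCompactSupport f) (k x : Fin d → ℝ) :
    Summable fun j => f (x + lattE d j) * blochPhase d k j := by
  obtain ⟨S, hS⟩ := hf.exists_finset_eventually_lattE x
  refine summable_of_ne_finset_zero (s := S) fun j hj => ?_
  rw [hS.self_of_nhds j hj, zero_mul]

lemma HasCompactSupport.exists_finset_blochT_eventuallyEq {d : ℕ} {f : (Fin d → ℝ) → ℂ}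
    (hf : HasCompactSupport f) (k x : Fin d → ℝ) :
    ∃ S : Finset (Fin d → ℤ), (∀ᶠ y in 𝓝 x, ∀ j ∉ S, f (y + lattE d j) = 0) ∧
      (BlochT d f k =ᶠ[𝓝 x]
        fun y => blochConst d * ∑ j ∈ S, f (y + lattE d j) * blochPhase d k j) := by
  obtain ⟨S, hS⟩ := hf.exists_finset_eventually_lattE x
  refine ⟨S, hS, ?_⟩
  filter_upwards [hS] with y hy
  rw [BlochT_eq, tsum_eq_sum fun j hj => by rw [hy j hj, zero_mul]]

lemma HasCompactSupport.contDiff_blochT {d : ℕ} {f : (Fin d → ℝ) → ℂ} {n : WithTop ℕ∞}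
    (hf : HasCompactSupport f) (hfn : ContDiff ℝ n f) (k : Fin d → ℝ) :
    ContDiff ℝ n (BlochT d f k) := by
  refine contDiff_iff_contDiffAt.mpr fun x => ?_
  obtain ⟨S, -, hS⟩ := hf.exists_finset_blochT_eventuallyEq k x
  refine ContDiffAt.congr_of_eventuallyEq (ContDiff.contDiffAt ?_) hS
  fun_prop

lemma HasCompactSupport.pdC {d : ℕ} {f : (Fin d → ℝ) → ℂ} (hf : HasCompactSupport f)
    (l : Fin d) : HasCompactSupport (pdC d l f) :=
  hf.fderiv_apply ℝ _

lemma ContDiff.pdC {d : ℕ} {f : (Fin d → ℝ) → ℂ} {m n : WithTop ℕ∞} (hf : ContDiff ℝ n f)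
    (hmn : m + 1 ≤ n) (l : Fin d) : ContDiff ℝ m (pdC d l f) :=
  (hf.fderiv_right hmn).clm_apply contDiff_const

/-- Partial derivatives commute with the Bloch transform. -/
lemma HasCompactSupport.pdC_blochT {d : ℕ} {f : (Fin d → ℝ) → ℂ}
    (hf : HasCompactSupport f) (hf1 : Differentiable ℝ f) (k : Fin d → ℝ) (l : Fin d) :
    _root_.pdC d l (BlochT d f k) = BlochT d (_root_.pdC d l f) k := by
  funext x
  obtain ⟨S, hS, hSeq⟩ := hf.exists_finset_blochT_eventuallyEq k x
  have hzero (j) (hj : j ∉ S) : _root_.pdC d l f (x + lattE d j) = 0 := by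
    have h : (fun y => f (y + lattE d j)) =ᶠ[𝓝 x] fun _ => 0 := by
      filter_upwards [hS] with y hy using hy j hj
    rw [_root_.pdC, ← fderiv_comp_add_right, h.fderiv_eq]
    simp
  have hterm (j : Fin d → ℤ) : HasFDerivAt (fun y => f (y + lattE d j) * blochPhase d k j)
      (blochPhase d k j • fderiv ℝ f (x + lattE d j)) x :=
    ((hasFDerivAt_comp_add_right _).mpr (hf1 _).hasFDerivAt).mul_const _
  rw [_root_.pdC, hSeq.fderiv_eq,
    ((HasFDerivAt.fun_sum fun j (_ : j ∈ S) => hterm j).const_mul (blochConst d)).fderiv,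
    BlochT_eq, tsum_eq_sum fun j hj => by rw [hzero j hj, zero_mul]]
  simp [_root_.pdC, mul_comm]

/-- Multiplication by a periodic function commutes with the Bloch transform. -/
lemma BlochT_periodic_mul {d : ℕ} {a : (Fin d → ℝ) → ℂ}
    (ha : ∀ (x : Fin d → ℝ) (z : Fin d → ℤ), a (x + lattE d z) = a x)
    (f : (Fin d → ℝ) → ℂ) (k x : Fin d → ℝ) :
    BlochT d (fun y => a y * f y) k x = a x * BlochT d f k x := by
  simp only [BlochT_eq, ha, mul_assoc, tsum_mul_left]
  ring

lemma BlochT_neg {d : ℕ} (f : (Fin d → ℝ) → ℂ) (k x : Fin d → ℝ) :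
    BlochT d (fun y => -f y) k x = -BlochT d f k x := by
  simp only [BlochT_eq, neg_mul, tsum_neg, mul_neg]

lemma BlochT_sub {d : ℕ} {f g : (Fin d → ℝ) → ℂ} (hf : HasCompactSupport f)
    (hg : HasCompactSupport g) (k x : Fin d → ℝ) :
    BlochT d (fun y => f y - g y) k x = BlochT d f k x - BlochT d g k x := by
  simp only [BlochT_eq, sub_mul, (hf.summable_blochT k x).tsum_sub (hg.summable_blochT k x),
    mul_sub]

lemma BlochT_sum {d : ℕ} {ι : Type*} (s : Finset ι) {f : ι → (Fin d → ℝ) → ℂ}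
    (hf : ∀ i ∈ s, HasCompactSupport (f i)) (k x : Fin d → ℝ) :
    BlochT d (fun y => ∑ i ∈ s, f i y) k x = ∑ i ∈ s, BlochT d (f i) k x := by
  simp only [BlochT_eq, Finset.sum_mul, ← Finset.mul_sum]
  rw [Summable.tsum_finsetSum fun i hi => (hf i hi).summable_blochT k x]

lemma HasCompactSupport.divGgrad {d : ℕ} {u : (Fin d → ℝ) → ℂ} (hu : HasCompactSupport u)
    (G : (Fin d → ℝ) → ℝ) : HasCompactSupport (divGgrad d G u) := by
  refine HasCompactSupport.intro' hu.isCompact (isClosed_tsupport u) fun x hx => ?_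
  refine Finset.sum_eq_zero fun l _ => image_eq_zero_of_notMem_tsupport fun h => hx ?_
  exact tsupport_fderiv_apply_subset ℝ _ (tsupport_mul_subset_right
    (tsupport_fderiv_apply_subset ℝ _ h))

/-- The divergence-form operator with periodic coefficient commutes with the Bloch transform. -/
lemma divGgrad_BlochT {d : ℕ} {G : (Fin d → ℝ) → ℝ} (hG : ContDiff ℝ 1 G)
    (hGper : ∀ (x : Fin d → ℝ) (z : Fin d → ℤ), G (x + lattE d z) = G x)
    {u : (Fin d → ℝ) → ℂ} (hu : ContDiff ℝ 2 u) (husupp : HasCompactSupport u)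
    (k x : Fin d → ℝ) :
    divGgrad d G (BlochT d u k) x = BlochT d (divGgrad d G u) k x := by
  have hsupp (l : Fin d) : HasCompactSupport fun y => (G y : ℂ) * pdC d l u y :=
    (husupp.pdC l).mul_left
  have hdiff (l : Fin d) : Differentiable ℝ fun y => (G y : ℂ) * pdC d l u y :=
    (((Complex.ofRealCLM.contDiff.comp hG).mul
      (hu.pdC (by norm_num [one_add_one_eq_two]) l)).differentiable one_ne_zero)
  unfold divGgrad
  rw [BlochT_sum _ fun l _ => (hsupp l).pdC l]
  refine Finset.sum_congr rfl fun l _ => ?_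
  rw [← (hsupp l).pdC_blochT (hdiff l), husupp.pdC_blochT (hu.differentiable two_ne_zero)]
  congr 1
  funext y
  exact (BlochT_periodic_mul (a := fun y => (G y : ℂ)) (fun x z => by rw [hGper]) _ k y).symm

/-- the Bloch transform intertwines the periodic-coefficient operator
`u ↦ −div(G∇u) − λρu`. -/
theorem bloch_intertwines_operator (d : ℕ) (hd : 1 ≤ d)
    (G : (Fin d → ℝ) → ℝ) (hG : ContDiff ℝ 1 G)
    (hGper : ∀ (x : Fin d → ℝ) (z : Fin d → ℤ), G (x + lattE d z) = G x)
    (ρ : (Fin d → ℝ) → ℝ)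
    (hρper : ∀ (x : Fin d → ℝ) (z : Fin d → ℤ), ρ (x + lattE d z) = ρ x)
    (lam : ℂ)
    (u : (Fin d → ℝ) → ℂ) (hu : ContDiff ℝ 2 u) (husupp : HasCompactSupport u)
    (g : (Fin d → ℝ) → ℂ)
    (hg : ∀ x, g x = -divGgrad d G u x - lam * (ρ x : ℂ) * u x) :
    ∀ k : Fin d → ℝ,
      ContDiff ℝ 2 (fun x => BlochT d u k x) ∧
      ∀ x : Fin d → ℝ,
        -divGgrad d G (fun y => BlochT d u k y) x - lam * (ρ x : ℂ) * BlochT d u k x =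
          BlochT d g k x := by
  intro k
  refine ⟨husupp.contDiff_blochT hu k, fun x => ?_⟩
  have hdiv : HasCompactSupport fun y => -divGgrad d G u y := (husupp.divGgrad G).neg
  have hmul : HasCompactSupport fun y => lam * (ρ y : ℂ) * u y := husupp.mul_left
  rw [funext hg, BlochT_sub hdiv hmul, BlochT_neg,
    BlochT_periodic_mul (a := fun y => lam * (ρ y : ℂ)) (fun x z => by rw [hρper]) u,
    ← divGgrad_BlochT hG hGper hu husupp]
end
end

section
/- Fix k ∈ ℝ^d. Let G : ℝ^d → ℝ be continuously differentiable and I-periodic, and let u, v : ℝ^d → ℂ be k-quasiperiodic, i.e. u(x+z) = e^{i k·z} u(x) and v(x+z) = e^{i k·z} v(x) for all x ∈ ℝ^d and z ∈ ℤ^d, with u twice continuously differentiable and v continuously differentiable. Then integration by parts over the unit cell produces no boundary terms: ∫_{[-1/2,1/2]^d} div(G∇u)(x) · conj(v(x)) dx = − ∫_{[-1/2,1/2]^d} G(x) ∇u(x) · conj(∇v(x)) dx. -/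
open MeasureTheory Complex Real Filter ComplexConjugate

noncomputable section

lemma contDiff_pdC {d : ℕ} (l : Fin d) {n m : WithTop ℕ∞} {f : (Fin d → ℝ) → ℂ}
    (hf : ContDiff ℝ n f) (hmn : m + 1 ≤ n) : ContDiff ℝ m (pdC d l f) :=
  (hf.fderiv_right hmn).clm_apply contDiff_const

lemma contDiff_conj {d : ℕ} {n : WithTop ℕ∞} {f : (Fin d → ℝ) → ℂ} (hf : ContDiff ℝ n f) :
    ContDiff ℝ n (fun x => conj (f x)) :=
  Complex.conjCLE.contDiff.comp hf

lemma pdC_conj {d : ℕ} (l : Fin d) {f : (Fin d → ℝ) → ℂ} {x : Fin d → ℝ}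
    (hf : DifferentiableAt ℝ f x) : pdC d l (fun y => conj (f y)) x = conj (pdC d l f x) := by
  have h : HasFDerivAt (fun y => conj (f y))
      ((Complex.conjCLE : ℂ →L[ℝ] ℂ).comp (fderiv ℝ f x)) x :=
    Complex.conjCLE.hasFDerivAt.comp x hf.hasFDerivAt
  simp [pdC, h.fderiv]

lemma pdC_mul {d : ℕ} (l : Fin d) {f g : (Fin d → ℝ) → ℂ} {x : Fin d → ℝ}
    (hf : DifferentiableAt ℝ f x) (hg : DifferentiableAt ℝ g x) :
    pdC d l (fun y => f y * g y) x = pdC d l f x * g x + f x * pdC d l g x := by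
  have h := hf.hasFDerivAt.mul hg.hasFDerivAt
  change fderiv ℝ (f * g) x (Pi.single l 1) = _
  rw [h.fderiv]
  simp only [pdC, add_apply, smul_apply, smul_eq_mul]
  ring

/-- A translation law `f (x + a) = c f x` passes to partial derivatives. -/
lemma pdC_add_of_forall_eq_mul {d : ℕ} (l : Fin d) {f : (Fin d → ℝ) → ℂ} {a : Fin d → ℝ} {c : ℂ}
    (hf : Differentiable ℝ f) (h : ∀ x, f (x + a) = c * f x) (x : Fin d → ℝ) :
    pdC d l f (x + a) = c * pdC d l f x := by
  have h' : (fun y => f (y + a)) = fun y => c * f y := funext h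
  rw [pdC, ← fderiv_comp_add_right, h', fderiv_const_mul (hf x)]
  rfl

/-- The divergence of a continuously differentiable periodic vector field has mean zero over the
unit cell. -/
lemma integral_divergence_eq_zero_of_periodic {d : ℕ} (hd : 1 ≤ d)
    {F : Fin d → (Fin d → ℝ) → ℂ} (hF : ∀ l, ContDiff ℝ 1 (F l))
    (hper : ∀ l (x : Fin d → ℝ) (z : Fin d → ℤ), F l (x + lattE d z) = F l x) :
    ∫ x in Set.Icc (fun _ : Fin d => -(1/2 : ℝ)) (fun _ : Fin d => (1/2 : ℝ)),
      ∑ l, pdC d l (F l) x = 0 := by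
  obtain ⟨n, rfl⟩ : ∃ n, d = n + 1 := ⟨d - 1, by omega⟩
  have hcont : Continuous fun x => ∑ l, pdC (n + 1) l (F l) x :=
    continuous_finsetSum _ fun l _ => (contDiff_pdC (m := 0) l (hF l) (by simp)).continuous
  have hdiv := integral_divergence_of_hasFDerivAt_off_countable'
    (fun _ : Fin (n + 1) => -(1/2 : ℝ)) (fun _ => (1/2 : ℝ))
    (fun _ => by norm_num) F (fun l => fderiv ℝ (F l)) ∅ Set.countable_empty
    (fun l => (hF l).continuous.continuousOn)
    (fun x _ l => ((hF l).differentiable one_ne_zero x).hasFDerivAt)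
    (hcont.continuousOn.integrableOn_compact isCompact_Icc)
  refine hdiv.trans (Finset.sum_eq_zero fun l _ => sub_eq_zero.2 ?_)
  congr 1
  ext y
  rw [← hper l (l.insertNth (-(1/2 : ℝ)) y) (Pi.single l 1)]
  congr 1
  ext j
  refine Fin.succAboveCases l ?_ (fun i => ?_) j
  · simp [lattE]; norm_num
  · simp [lattE]

/-- integration by parts over the unit cell for `k`-quasiperiodic functions
produces no boundary terms:
`∫_cell div(G∇u) conj(v) = − ∫_cell G ∇u · conj(∇v)`. -/
theorem cell_integration_by_parts (d : ℕ) (hd : 1 ≤ d) (k : Fin d → ℝ)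
    (G : (Fin d → ℝ) → ℝ) (hG : ContDiff ℝ 1 G)
    (hGper : ∀ (x : Fin d → ℝ) (z : Fin d → ℤ), G (x + lattE d z) = G x)
    (u v : (Fin d → ℝ) → ℂ)
    (hu : ContDiff ℝ 2 u) (hv : ContDiff ℝ 1 v)
    (huqp : ∀ (x : Fin d → ℝ) (z : Fin d → ℤ),
      u (x + lattE d z) = Complex.exp (Complex.I * ((dotE d k (lattE d z) : ℝ) : ℂ)) * u x)
    (hvqp : ∀ (x : Fin d → ℝ) (z : Fin d → ℤ),
      v (x + lattE d z) = Complex.exp (Complex.I * ((dotE d k (lattE d z) : ℝ) : ℂ)) * v x) :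
    (∫ x in Set.Icc (fun _ : Fin d => -(1/2 : ℝ)) (fun _ : Fin d => (1/2 : ℝ)),
        divGgrad d G u x * conj (v x)) =
      -∫ x in Set.Icc (fun _ : Fin d => -(1/2 : ℝ)) (fun _ : Fin d => (1/2 : ℝ)),
        (G x : ℂ) * ∑ l, pdC d l u x * conj (pdC d l v x) := by
  have hGC : ContDiff ℝ 1 (fun x => (G x : ℂ)) := Complex.ofRealCLM.contDiff.comp hG
  have hud (l) : ContDiff ℝ 1 (pdC d l u) := contDiff_pdC l hu (by norm_num)
  have hflux (l) : ContDiff ℝ 1 (fun x => (G x : ℂ) * pdC d l u x) := hGC.mul (hud l)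
  have hvc : ContDiff ℝ 1 (fun x => conj (v x)) := contDiff_conj hv
  have hzero := integral_divergence_eq_zero_of_periodic hd
    (F := fun l x => (G x : ℂ) * pdC d l u x * conj (v x)) (fun l => (hflux l).mul hvc)
    (fun l x z => by
      have hphase : Complex.exp (Complex.I * ((dotE d k (lattE d z) : ℝ) : ℂ)) *
          conj (Complex.exp (Complex.I * ((dotE d k (lattE d z) : ℝ) : ℂ))) = 1 := by
        rw [← Complex.exp_conj, ← Complex.exp_add]
        simp
      simp only [hGper, hvqp, map_mul,
        pdC_add_of_forall_eq_mul l (hu.differentiable two_ne_zero) (fun y => huqp y z)]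
      linear_combination ((G x : ℂ) * pdC d l u x * conj (v x)) * hphase)
  have hsplit (x : Fin d → ℝ) :
      ∑ l, pdC d l (fun x => (G x : ℂ) * pdC d l u x * conj (v x)) x =
        divGgrad d G u x * conj (v x) + (G x : ℂ) * ∑ l, pdC d l u x * conj (pdC d l v x) := by
    rw [divGgrad, Finset.sum_mul, Finset.mul_sum, ← Finset.sum_add_distrib]
    refine Finset.sum_congr rfl fun l _ => ?_
    rw [pdC_mul l ((hflux l).differentiable one_ne_zero x) (hvc.differentiable one_ne_zero x),
      pdC_conj l (hv.differentiable one_ne_zero x), mul_assoc (G x : ℂ)]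
  have hdivc : Continuous fun x => divGgrad d G u x * conj (v x) :=
    (continuous_finsetSum _ fun l _ =>
      (contDiff_pdC (m := 0) l (hflux l) (by simp)).continuous).mul hvc.continuous
  have hgradc : Continuous fun x => (G x : ℂ) * ∑ l, pdC d l u x * conj (pdC d l v x) :=
    hGC.continuous.mul <| continuous_finsetSum _ fun l _ => (hud l).continuous.mul
      (contDiff_conj (contDiff_pdC (m := 0) l hv (by simp))).continuous
  simp only [hsplit] at hzero
  rw [integral_add (hdivc.continuousOn.integrableOn_compact isCompact_Icc)
    (hgradc.continuousOn.integrableOn_compact isCompact_Icc)] at hzero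
  exact eq_neg_of_add_eq_zero_left hzero
end
end
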